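/- arXiv:1908.04109 — 3 statements merged into one kernel-verified Lean document; each statement's English description precedes it below -/
import Mathlib

section
/- Let x and y be two nonzero vectors in ℝ^m that are not scalar multiples of one another, let u = x/‖x‖₂, assume ‖x‖₂ > ‖y‖₂, and let β > 1. Then α* = 1 − √(1 − (β‖x‖₂² − ‖y‖₂²)/(β(uᵀx)² − (uᵀy)²)) is the unique solution α ∈ (0,1) of the equation ‖(I − α u uᵀ) y‖₂² = β ‖(I − α u uᵀ) x‖₂². -/
open RealInnerProductSpace

/-- The squared norm of `(I - α u uᵀ) z` for a unit vector `u`. -/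
lemma norm_sub_smul_inner_smul_sq {E : Type*} [NormedAddCommGroup E] [InnerProductSpace ℝ E]
    {u : E} (hu : ‖u‖ = 1) (z : E) (α : ℝ) :
    ‖z - α • ⟪u, z⟫ • u‖ ^ 2 = ‖z‖ ^ 2 - (1 - (1 - α) ^ 2) * ⟪u, z⟫ ^ 2 := by
  rw [norm_sub_sq_real, smul_smul, real_inner_smul_right, norm_smul, hu, real_inner_comm u z,
    mul_one, Real.norm_eq_abs, sq_abs]
  ring

/-- Lemma 1 of the paper: given nonzero vectors `x`, `y` in `ℝ^m` that are not scalar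
multiples of one another, `u = x/‖x‖₂`, `‖x‖₂ > ‖y‖₂` and `β > 1`, the value
`α* = 1 − √(1 − (β‖x‖² − ‖y‖²)/(β(uᵀx)² − (uᵀy)²))` is the unique `α ∈ (0,1)` with
`‖(I − α u uᵀ) y‖² = β ‖(I − α u uᵀ) x‖²`.  Here `(I − α u uᵀ) z = z − α (uᵀz) u`. -/
theorem rspa_alpha_unique {m : ℕ} (x y u : EuclideanSpace ℝ (Fin m))
    (hx : x ≠ 0) (hy : y ≠ 0)
    (hnm : ∀ t : ℝ, x ≠ t • y ∧ y ≠ t • x)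
    (hu : u = ‖x‖⁻¹ • x)
    (hxy : ‖y‖ < ‖x‖)
    (β : ℝ) (hβ : 1 < β)
    (αstar : ℝ)
    (hαstar : αstar =
      1 - Real.sqrt (1 - (β * ‖x‖ ^ 2 - ‖y‖ ^ 2) / (β * ⟪u, x⟫ ^ 2 - ⟪u, y⟫ ^ 2))) :
    ∀ α : ℝ,
      (α ∈ Set.Ioo (0 : ℝ) 1 ∧
        ‖y - α • ⟪u, y⟫ • u‖ ^ 2 = β * ‖x - α • ⟪u, x⟫ • u‖ ^ 2)
      ↔ α = αstar := by
  have hx0 : 0 < ‖x‖ := norm_pos_iff.mpr hx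
  have hu1 : ‖u‖ = 1 := by
    rw [hu, norm_smul, norm_inv, norm_norm, inv_mul_cancel₀ hx0.ne']
  have hux : ⟪u, x⟫ = ‖x‖ := by
    rw [hu, real_inner_smul_left, real_inner_self_eq_norm_sq]
    field_simp
  have hc : ⟪u, y⟫ ^ 2 < ‖y‖ ^ 2 := by
    have hne : y - (1 : ℝ) • ⟪u, y⟫ • u ≠ 0 := by
      intro h
      apply (hnm (⟪u, y⟫ * ‖x‖⁻¹)).2
      rw [mul_smul, ← hu]
      simpa [sub_eq_zero] using h
    have hpos := pow_pos (norm_pos_iff.mpr hne) 2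
    rw [norm_sub_smul_inner_smul_sq hu1] at hpos
    linarith
  have hN : 0 < β * ‖x‖ ^ 2 - ‖y‖ ^ 2 := by
    have := pow_lt_pow_left₀ hxy (norm_nonneg y) two_ne_zero
    nlinarith [pow_pos hx0 2]
  rw [hux] at hαstar
  intro α
  rw [norm_sub_smul_inner_smul_sq hu1, norm_sub_smul_inner_smul_sq hu1, hux, hαstar]
  set D := β * ‖x‖ ^ 2 - ⟪u, y⟫ ^ 2 with hD
  set N := β * ‖x‖ ^ 2 - ‖y‖ ^ 2 with hN'
  have hD0 : 0 < D := by linarith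
  have hr1 : N / D < 1 := (div_lt_one hD0).mpr (by linarith)
  have hr0 : 0 < N / D := div_pos hN hD0
  have hND : N / D * D = N := div_mul_cancel₀ N hD0.ne'
  constructor
  · rintro ⟨⟨h0, h1⟩, h⟩
    have hsq : 1 - N / D = (1 - α) ^ 2 := by
      apply mul_right_cancel₀ hD0.ne'
      rw [sub_mul, hND]
      linear_combination h
    rw [hsq, Real.sqrt_sq (by linarith)]
    ring
  · rintro rfl
    have hs0 : 0 < √(1 - N / D) := Real.sqrt_pos.mpr (by linarith)
    have hs1 : √(1 - N / D) < 1 := (Real.sqrt_lt' one_pos).mpr (by linarith)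
    refine ⟨⟨by linarith, by linarith⟩, ?_⟩
    rw [sub_sub_cancel, Real.sq_sqrt (by linarith), sub_sub_cancel]
    linear_combination hND
end

section
/- Let x and y be two nonzero vectors in ℝ^m that are not scalar multiples of one another, let u = x/‖x‖₂, assume ‖x‖₂ > ‖y‖₂, let β > 1, and set Δ = β(uᵀx)² − (uᵀy)². Then 0 < (β‖x‖₂² − ‖y‖₂²)/Δ < 1, and hence α* = 1 − √(1 − (β‖x‖₂² − ‖y‖₂²)/Δ) satisfies 0 < α* < 1. -/
open RealInnerProductSpace

/-- Strict Cauchy–Schwarz against a unit vector `u`, for `y` off the line spanned by `u`. -/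
theorem inner_sq_lt_norm_sq_of_ne_smul {E : Type*} [NormedAddCommGroup E]
    [InnerProductSpace ℝ E] {u y : E} (hu : ‖u‖ = 1) (hy : ∀ t : ℝ, y ≠ t • u) :
    ⟪u, y⟫ ^ 2 < ‖y‖ ^ 2 := by
  have hpos : 0 < ‖y - ⟪u, y⟫ • u‖ ^ 2 :=
    pow_pos (norm_pos_iff.mpr (sub_ne_zero.mpr (hy _))) 2
  rw [norm_sub_sq_real, inner_smul_right, norm_smul, hu, mul_one, Real.norm_eq_abs, sq_abs,
    real_inner_comm] at hpos
  rw [real_inner_comm]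
  linarith

/-- Under the hypotheses of Lemma 1, with `Δ = β(uᵀx)² − (uᵀy)²`, one has
`0 < (β‖x‖₂² − ‖y‖₂²)/Δ < 1`, and hence
`α* = 1 − √(1 − (β‖x‖₂² − ‖y‖₂²)/Δ)` satisfies `0 < α* < 1`. -/
theorem rspa_alpha_in_unit_interval {m : ℕ} (x y u : EuclideanSpace ℝ (Fin m))
    (hx : x ≠ 0) (hy : y ≠ 0)
    (hnm : ∀ t : ℝ, x ≠ t • y ∧ y ≠ t • x)
    (hu : u = ‖x‖⁻¹ • x)
    (hxy : ‖y‖ < ‖x‖)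
    (β : ℝ) (hβ : 1 < β)
    (Δ : ℝ) (hΔ : Δ = β * ⟪u, x⟫ ^ 2 - ⟪u, y⟫ ^ 2)
    (αstar : ℝ)
    (hαstar : αstar = 1 - Real.sqrt (1 - (β * ‖x‖ ^ 2 - ‖y‖ ^ 2) / Δ)) :
    (0 < (β * ‖x‖ ^ 2 - ‖y‖ ^ 2) / Δ ∧ (β * ‖x‖ ^ 2 - ‖y‖ ^ 2) / Δ < 1) ∧
      0 < αstar ∧ αstar < 1 := by
  have hx0 : 0 < ‖x‖ := norm_pos_iff.mpr hx
  have hu1 : ‖u‖ = 1 := by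
    rw [hu, norm_smul, norm_inv, norm_norm, inv_mul_cancel₀ hx0.ne']
  have hux : ⟪u, x⟫ = ‖x‖ := by
    rw [hu, real_inner_smul_left, real_inner_self_eq_norm_sq]
    field_simp
  have huy : ⟪u, y⟫ ^ 2 < ‖y‖ ^ 2 := by
    refine inner_sq_lt_norm_sq_of_ne_smul hu1 fun t ht => (hnm (t * ‖x‖⁻¹)).2 ?_
    rw [ht, hu, smul_smul]
  have hnum : 0 < β * ‖x‖ ^ 2 - ‖y‖ ^ 2 := by
    have hsq : ‖y‖ ^ 2 < ‖x‖ ^ 2 := by gcongr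
    nlinarith [pow_pos hx0 2]
  have hlt : β * ‖x‖ ^ 2 - ‖y‖ ^ 2 < Δ := by
    rw [hΔ, hux]
    linarith
  have hΔpos : 0 < Δ := hnum.trans hlt
  have h0 := div_pos hnum hΔpos
  have h1 := (div_lt_one hΔpos).mpr hlt
  refine ⟨⟨h0, h1⟩, ?_, ?_⟩
  · rw [hαstar, sub_pos, Real.sqrt_lt' one_pos]
    linarith
  · rw [hαstar, sub_lt_self_iff]
    exact Real.sqrt_pos.mpr (sub_pos.mpr h1)
end

section
/- Let x and y be two nonzero vectors in ℝ^m that are not scalar multiples of one another, let u = x/‖x‖₂, assume ‖x‖₂ > ‖y‖₂, let β > 1, and define g(α) = ‖(I − α u uᵀ) y‖₂² − β ‖(I − α u uᵀ) x‖₂². Then g(0) = ‖y‖₂² − β‖x‖₂² < 0 and g(1) = ‖y‖₂² − (uᵀy)² > 0; in particular, by continuity there exists α ∈ (0,1) with g(α) = 0. -/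
open RealInnerProductSpace

/-- Under the hypotheses of Lemma 1, the function
`g(α) = ‖(I − α u uᵀ) y‖₂² − β ‖(I − α u uᵀ) x‖₂²` satisfies
`g(0) = ‖y‖₂² − β‖x‖₂² < 0` and `g(1) = ‖y‖₂² − (uᵀy)² > 0`; in particular there exists
`α ∈ (0,1)` with `g(α) = 0`. -/
theorem rspa_sign_change {m : ℕ} (x y u : EuclideanSpace ℝ (Fin m))
    (hx : x ≠ 0) (hy : y ≠ 0)
    (hnm : ∀ t : ℝ, x ≠ t • y ∧ y ≠ t • x)
    (hu : u = ‖x‖⁻¹ • x)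
    (hxy : ‖y‖ < ‖x‖)
    (β : ℝ) (hβ : 1 < β)
    (g : ℝ → ℝ)
    (hg : ∀ α : ℝ, g α = ‖y - α • ⟪u, y⟫ • u‖ ^ 2 - β * ‖x - α • ⟪u, x⟫ • u‖ ^ 2) :
    (g 0 = ‖y‖ ^ 2 - β * ‖x‖ ^ 2 ∧ g 0 < 0) ∧
      (g 1 = ‖y‖ ^ 2 - ⟪u, y⟫ ^ 2 ∧ 0 < g 1) ∧
      ∃ α ∈ Set.Ioo (0 : ℝ) 1, g α = 0 := by
  have hx0 : ‖x‖ ≠ 0 := norm_ne_zero_iff.mpr hx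
  have hu1 : ‖u‖ = 1 := by rw [hu, norm_smul, norm_inv, norm_norm, inv_mul_cancel₀ hx0]
  have hproj : ⟪u, x⟫ • u = x := by
    rw [hu, real_inner_smul_left, real_inner_self_eq_norm_sq, smul_smul]
    have h : ‖x‖⁻¹ * ‖x‖ ^ 2 * ‖x‖⁻¹ = 1 := by field_simp
    rw [h, one_smul]
  have hg0 : g 0 = ‖y‖ ^ 2 - β * ‖x‖ ^ 2 := by simp [hg]
  have hneg : g 0 < 0 := by
    have hsq : ‖y‖ ^ 2 < ‖x‖ ^ 2 := by gcongr
    rw [hg0]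
    nlinarith [sq_nonneg ‖x‖]
  have hg1' : g 1 = ‖y - ⟪u, y⟫ • u‖ ^ 2 := by simp [hg, hproj]
  have hg1 : g 1 = ‖y‖ ^ 2 - ⟪u, y⟫ ^ 2 := by
    rw [hg1', norm_sub_sq_real, real_inner_smul_right, real_inner_comm, norm_smul, hu1,
      mul_one, Real.norm_eq_abs, sq_abs]
    ring
  have hpos : 0 < g 1 := by
    rw [hg1']
    have hne : y - ⟪u, y⟫ • u ≠ 0 := fun h =>
      (hnm (⟪u, y⟫ * ‖x‖⁻¹)).2 <| by
        rw [mul_smul, ← hu]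
        exact sub_eq_zero.mp h
    exact pow_pos (norm_pos_iff.mpr hne) 2
  have hcont : Continuous g := by
    rw [funext hg]
    fun_prop
  exact ⟨⟨hg0, hneg⟩, ⟨hg1, hpos⟩,
    intermediate_value_Ioo zero_le_one hcont.continuousOn ⟨hneg, hpos⟩⟩
end
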